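/- Assume p > 2, or α < max(N, η). Then for any m > 0, any solution w of equation (E) defined on [m,∞) either is identically zero on [m,∞) or has only finitely many isolated zeros in [m,∞). -/

import Mathlib

open Set Filter Topology Asymptotics

/-- The p-Laplacian nonlinearity φ_p(x) = |x|^{p-2} x. -/
noncomputable def phiP (p x : ℝ) : ℝ := |x| ^ (p - 2) * x

/-- `w` is a solution of equation (E) on the interval `I ⊆ (0,∞)`:
`w` is C¹ on `I`, `|w'|^{p-2} w'` is C¹ on `I`, and the equation
`(|w'|^{p-2}w')' + ((N-1)/r)|w'|^{p-2}w' + r w' + α w + |w|^{q-1} w = 0`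
holds on `I` (derivatives taken within `I`). -/
def IsSolutionOn (N : ℕ) (p q α : ℝ) (w : ℝ → ℝ) (I : Set ℝ) : Prop :=
  ContDiffOn ℝ 1 w I ∧
  ContDiffOn ℝ 1 (fun r => phiP p (derivWithin w I r)) I ∧
  ∀ r ∈ I,
    derivWithin (fun s => phiP p (derivWithin w I s)) I r
      + ((N : ℝ) - 1) / r * phiP p (derivWithin w I r)
      + r * derivWithin w I r + α * w r + |w r| ^ (q - 1) * w r = 0

/-- `w` is the global solution of (E) on `[0,∞)` with `w(0) = a`, `w'(0) = 0`:
`w ∈ C¹([0,∞))`, `|w'|^{p-2}w' ∈ C¹([0,∞))`, and (E) holds on `(0,∞)`. -/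
def IsGlobalSolution (N : ℕ) (p q α a : ℝ) (w : ℝ → ℝ) : Prop :=
  ContDiffOn ℝ 1 w (Ici 0) ∧
  ContDiffOn ℝ 1 (fun r => phiP p (derivWithin w (Ici 0) r)) (Ici 0) ∧
  (∀ r ∈ Ioi (0 : ℝ),
    derivWithin (fun s => phiP p (derivWithin w (Ici 0) s)) (Ici 0) r
      + ((N : ℝ) - 1) / r * phiP p (derivWithin w (Ici 0) r)
      + r * derivWithin w (Ici 0) r + α * w r + |w r| ^ (q - 1) * w r = 0) ∧
  w 0 = a ∧ derivWithin w (Ici 0) 0 = 0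

/-- `r` is an isolated zero of `w` relative to the set `I`. -/
def IsIsolatedZeroOn (w : ℝ → ℝ) (I : Set ℝ) (r : ℝ) : Prop :=
  r ∈ I ∧ w r = 0 ∧ ∀ᶠ s in 𝓝[I \ {r}] r, w s ≠ 0

/-- `w` has at least `n` isolated zeros in `(0,∞)`. -/
def HasAtLeastIsolatedZeros (w : ℝ → ℝ) (n : ℕ) : Prop :=
  ∃ z : Fin n → ℝ, StrictMono z ∧ ∀ i, 0 < z i ∧ IsIsolatedZeroOn w (Ici 0) (z i)

section PhiP

lemma phiP_neg (p x : ℝ) : phiP p (-x) = -phiP p x := by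
  simp [phiP]

lemma phiP_zero (p : ℝ) : phiP p 0 = 0 := by
  simp [phiP]

lemma phiP_of_pos (p : ℝ) {x : ℝ} (hx : 0 < x) : phiP p x = x ^ (p - 1) := by
  rw [phiP, abs_of_pos hx, show p - 1 = p - 2 + 1 by ring, Real.rpow_add_one hx.ne']

lemma phiP_pos (p : ℝ) {x : ℝ} (hx : 0 < x) : 0 < phiP p x := by
  rw [phiP_of_pos p hx]; positivity

lemma phiP_nonneg (p : ℝ) {x : ℝ} (hx : 0 ≤ x) : 0 ≤ phiP p x := by
  unfold phiP; positivity

lemma phiP_mul_self_nonneg (p x : ℝ) : 0 ≤ x * phiP p x := by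
  have : x * phiP p x = |x| ^ (p - 2) * x ^ 2 := by unfold phiP; ring
  rw [this]; positivity

lemma phiP_eq_zero {p x : ℝ} (h : phiP p x = 0) : x = 0 := by
  rcases lt_trichotomy x 0 with hx | hx | hx
  · have := phiP_pos p (neg_pos.2 hx)
    rw [phiP_neg] at this; linarith
  · exact hx
  · exact absurd h (ne_of_gt (phiP_pos p hx))

/-- `phiP` at the conjugate exponent inverts `phiP p`. -/
lemma phiP_conj_phiP {p : ℝ} (hp : 1 < p) (x : ℝ) : phiP (p / (p - 1)) (phiP p x) = x := by
  have hp0 : p - 1 ≠ 0 := by linarith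
  have key : ∀ y : ℝ, 0 < y → phiP (p / (p - 1)) (phiP p y) = y := by
    intro y hy
    rw [phiP_of_pos _ (phiP_pos p hy), phiP_of_pos p hy, ← Real.rpow_mul hy.le]
    rw [show (p - 1) * (p / (p - 1) - 1) = 1 by field_simp; ring, Real.rpow_one]
  rcases lt_trichotomy x 0 with hx | hx | hx
  · have := key (-x) (neg_pos.2 hx)
    rw [phiP_neg, phiP_neg] at this; linarith
  · simp [hx, phiP_zero]
  · exact key x hx

/-- A lower barrier for `φ_p` at a negative level. -/
lemma neg_lt_of_neg_rpow_lt_phiP {p x z : ℝ} (hp : 1 < p) (hz : 0 < z)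
    (h : -z ^ (p - 1) < phiP p x) : -z < x := by
  by_contra! hx
  have hx' : z ≤ -x := by linarith
  have h1 := Real.rpow_le_rpow hz.le hx' (by linarith : 0 ≤ p - 1)
  rw [← phiP_of_pos p (by linarith : 0 < -x), phiP_neg] at h1
  linarith

end PhiP

/-- First order form of the equation on `[m,∞)`, with `u` standing for `w'`. -/
structure IsFlow (N : ℕ) (p q α m : ℝ) (w u : ℝ → ℝ) : Prop where
  hasDeriv : ∀ r ∈ Ici m, HasDerivWithinAt w (u r) (Ici m) r
  cont : ContinuousOn u (Ici m)
  hasDeriv_phi : ∀ r ∈ Ici m, HasDerivWithinAt (fun s => phiP p (u s))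
    (-(((N : ℝ) - 1) / r * phiP p (u r)) - r * u r - α * w r - |w r| ^ (q - 1) * w r) (Ici m) r

/-- The energy, which decreases along solutions. -/
noncomputable def energy (p q α : ℝ) (w u : ℝ → ℝ) (r : ℝ) : ℝ :=
  (p - 1) / p * |phiP p (u r)| ^ (p / (p - 1)) + α / 2 * w r ^ 2 + |w r| ^ (q + 1) / (q + 1)

section Flow

variable {N : ℕ} {p q α m : ℝ} {w u : ℝ → ℝ}

lemma IsSolutionOn.isFlow (hw : IsSolutionOn N p q α w (Ici m)) :
    IsFlow N p q α m w (derivWithin w (Ici m)) := by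
  obtain ⟨h1, h2, h3⟩ := hw
  refine ⟨fun r hr => (h1.differentiableOn one_ne_zero r hr).hasDerivWithinAt,
    h1.continuousOn_derivWithin (uniqueDiffOn_Ici m) le_rfl, fun r hr => ?_⟩
  have := (h2.differentiableOn one_ne_zero r hr).hasDerivWithinAt
  exact this.congr_deriv (by linarith [h3 r hr])

namespace IsFlow

lemma neg (hf : IsFlow N p q α m w u) :
    IsFlow N p q α m (fun r => -w r) (fun r => -u r) := by
  refine ⟨fun r hr => (hf.hasDeriv r hr).fun_neg, hf.cont.neg, fun r hr => ?_⟩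
  simp only [phiP_neg, abs_neg]
  exact (hf.hasDeriv_phi r hr).fun_neg.congr_deriv (by ring)

lemma continuousOn (hf : IsFlow N p q α m w u) : ContinuousOn w (Ici m) :=
  fun r hr => (hf.hasDeriv r hr).continuousWithinAt

lemma continuousOn_phi (hf : IsFlow N p q α m w u) :
    ContinuousOn (fun s => phiP p (u s)) (Ici m) :=
  fun r hr => (hf.hasDeriv_phi r hr).continuousWithinAt

lemma hasDerivAt (hf : IsFlow N p q α m w u) {r : ℝ} (hr : m < r) : HasDerivAt w (u r) r :=
  (hf.hasDeriv r hr.le).hasDerivAt (Ici_mem_nhds hr)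

lemma hasDerivAt_phi (hf : IsFlow N p q α m w u) {r : ℝ} (hr : m < r) :
    HasDerivAt (fun s => phiP p (u s))
      (-(((N : ℝ) - 1) / r * phiP p (u r)) - r * u r - α * w r - |w r| ^ (q - 1) * w r) r :=
  (hf.hasDeriv_phi r hr.le).hasDerivAt (Ici_mem_nhds hr)

lemma hasDerivWithinAt_energy (hf : IsFlow N p q α m w u) (hp : 1 < p) (hq : 1 < q) {r : ℝ}
    (hr : r ∈ Ici m) :
    HasDerivWithinAt (energy p q α w u)
      (-(((N : ℝ) - 1) / r * (u r * phiP p (u r))) - r * u r ^ 2) (Ici m) r := by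
  have hp1 : 1 < p / (p - 1) := by rw [lt_div_iff₀ (by linarith)]; linarith
  have e1 := ((hasDerivAt_abs_rpow (phiP p (u r)) hp1).comp_hasDerivWithinAt r
    (hf.hasDeriv_phi r hr)).const_mul ((p - 1) / p)
  have e2 := ((hf.hasDeriv r hr).fun_pow 2).const_mul (α / 2)
  have e3 := ((hasDerivAt_abs_rpow (w r) (by linarith : 1 < q + 1)).comp_hasDerivWithinAt r
    (hf.hasDeriv r hr)).div_const (q + 1)
  have e := (e1.add e2).add e3
  refine e.congr_deriv ?_
  have hc : |phiP p (u r)| ^ (p / (p - 1) - 2) * phiP p (u r) = u r := phiP_conj_phiP hp (u r)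
  have hp0 : p - 1 ≠ 0 := by linarith
  have hp00 : p ≠ 0 := by linarith
  have hq0 : q + 1 ≠ 0 := by linarith
  rw [mul_assoc (p / (p - 1)), hc, show q + 1 - 2 = q - 1 by ring]
  field_simp
  ring

lemma antitoneOn_energy (hf : IsFlow N p q α m w u) (hN : 1 ≤ N) (hp : 1 < p) (hq : 1 < q)
    (hm : 0 < m) : AntitoneOn (energy p q α w u) (Ici m) := by
  refine antitoneOn_of_hasDerivWithinAt_nonpos (convex_Ici m)
    (fun r hr => (hf.hasDerivWithinAt_energy hp hq hr).continuousWithinAt)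
    (fun r hr => (hf.hasDerivWithinAt_energy hp hq (interior_subset hr)).mono interior_subset) ?_
  intro r hr
  have hr0 : 0 < r := hm.trans_le (interior_subset hr)
  have h1 : (1 : ℝ) ≤ N := by exact_mod_cast hN
  have h2 : 0 ≤ ((N : ℝ) - 1) / r := div_nonneg (by linarith) hr0.le
  have h3 := mul_nonneg h2 (phiP_mul_self_nonneg p (u r))
  have h4 : 0 ≤ r * u r ^ 2 := by positivity
  linarith

end IsFlow

lemma sq_le_energy (hp : 1 < p) (hq : 1 < q) (r : ℝ) :
    α / 2 * w r ^ 2 ≤ energy p q α w u r := by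
  have h1 : 0 ≤ (p - 1) / p * |phiP p (u r)| ^ (p / (p - 1)) :=
    mul_nonneg (div_nonneg (by linarith) (by linarith)) (by positivity)
  have h2 : 0 ≤ |w r| ^ (q + 1) / (q + 1) := div_nonneg (by positivity) (by linarith)
  unfold energy; linarith

lemma phi_le_energy (hq : 1 < q) (hα : 0 < α) (r : ℝ) :
    (p - 1) / p * |phiP p (u r)| ^ (p / (p - 1)) ≤ energy p q α w u r := by
  have h2 : 0 ≤ |w r| ^ (q + 1) / (q + 1) := div_nonneg (by positivity) (by linarith)
  have h3 : 0 ≤ α / 2 * w r ^ 2 := by positivity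
  unfold energy; linarith

lemma energy_eq_zero (hp : 1 < p) (hq : 1 < q) {r : ℝ} (hw : w r = 0) (hu : u r = 0) :
    energy p q α w u r = 0 := by
  have h1 : p / (p - 1) ≠ 0 := div_ne_zero (by linarith) (by linarith)
  have h2 : q + 1 ≠ 0 := by linarith
  simp [energy, hw, hu, phiP_zero, Real.zero_rpow h1, Real.zero_rpow h2]

lemma deriv_nonneg_of_nonneg_right {f : ℝ → ℝ} {f' a b : ℝ}
    (hf : HasDerivWithinAt f f' (Ioi a) a) (ha : f a = 0) (hab : a < b)
    (hpos : ∀ r ∈ Ioo a b, 0 ≤ f r) : 0 ≤ f' := by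
  have h := hasDerivWithinAt_iff_tendsto_slope.1 hf
  rw [sdiff_singleton_eq_self self_notMem_Ioi] at h
  refine ge_of_tendsto h ?_
  filter_upwards [Ioo_mem_nhdsGT hab] with r hr
  rw [slope_def_field, ha, sub_zero]
  exact div_nonneg (hpos r hr) (sub_nonneg.2 hr.1.le)

lemma deriv_nonpos_of_nonneg_left {f : ℝ → ℝ} {f' a b : ℝ}
    (hf : HasDerivWithinAt f f' (Iio b) b) (hb : f b = 0) (hab : a < b)
    (hpos : ∀ r ∈ Ioo a b, 0 ≤ f r) : f' ≤ 0 := by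
  have h := hasDerivWithinAt_iff_tendsto_slope.1 hf
  rw [sdiff_singleton_eq_self self_notMem_Iio] at h
  refine le_of_tendsto h ?_
  filter_upwards [Ioo_mem_nhdsLT hab] with r hr
  rw [slope_def_field, hb, sub_zero]
  exact div_nonpos_of_nonneg_of_nonpos (hpos r hr) (sub_nonpos.2 hr.2.le)

lemma exists_right_pos_of_hasDerivAt {f : ℝ → ℝ} {f' s : ℝ} (hf : HasDerivAt f f' s)
    (hs : f s = 0) (hf' : 0 < f') : ∀ᶠ r in 𝓝[>] s, 0 < f r := by
  have h := (hasDerivAt_iff_tendsto_slope.1 hf).mono_left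
    (nhdsWithin_mono s fun r (hr : s < r) => hr.ne')
  filter_upwards [h.eventually (lt_mem_nhds hf'), self_mem_nhdsWithin] with r hr hsr
  rw [slope_def_field, hs, sub_zero] at hr
  exact (div_pos_iff_of_pos_right (sub_pos.2 hsr)).1 hr

/-- If every positive small critical value of `r ^ d * w` is a strict local minimum, then
`w` has no small positive bumps. -/
lemma IsFlow.no_pos_bump_of_rpow (hf : IsFlow N p q α m w u) (hp : 1 < p) (hm : 0 < m)
    {d ε : ℝ} (hd : 0 < d)
    (hε : ∀ x ∈ Ioo 0 ε, ∀ s, m ≤ s → 0 < (d * x / s) ^ (p - 1) / s *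
      ((N : ℝ) - 1 - (p - 1) * (d + 1)) + x * (d - α - x ^ (q - 1)))
    {a b : ℝ} (ha : m ≤ a) (hab : a < b) (hwa : w a = 0) (hwb : w b = 0)
    (hpos : ∀ r ∈ Ioo a b, 0 < w r) (hsmall : ∀ r ∈ Ioo a b, w r < ε) : False := by
  have hsub : Icc a b ⊆ Ici m := fun r hr => ha.trans hr.1
  have hyc : ContinuousOn (fun r => r ^ d * w r) (Icc a b) :=
    (ContinuousOn.rpow_const continuousOn_id fun r hr =>
      Or.inl (hm.trans_le (hsub hr)).ne').mul (hf.continuousOn.mono hsub)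
  obtain ⟨s, hs, hext⟩ := exists_Ioo_extr_on_Icc hab hyc (by simp [hwa, hwb])
  have hms : m < s := ha.trans_lt hs.1
  have hs0 : 0 < s := hm.trans hms
  have hws := hpos s hs
  have hmax : IsMaxOn (fun r => r ^ d * w r) (Icc a b) s := by
    refine hext.resolve_left fun hmin => ?_
    have h1 : s ^ d * w s ≤ a ^ d * w a := hmin (left_mem_Icc.2 hab.le)
    have h2 : 0 < s ^ d * w s := by positivity
    rw [hwa] at h1; linarith
  have hy : ∀ r, m < r →
      HasDerivAt (fun r => r ^ d * w r) (r ^ d * (d * w r / r + u r)) r := fun r hr => by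
    have hr0 : 0 < r := hm.trans hr
    refine ((Real.hasDerivAt_rpow_const (p := d) (Or.inl hr0.ne')).mul
      (hf.hasDerivAt hr)).congr_deriv ?_
    rw [Real.rpow_sub_one hr0.ne']; field_simp
  have hus : u s = -(d * w s / s) := by
    have h1 := (hmax.isLocalMax (Icc_mem_nhds hs.1 hs.2)).hasDerivAt_eq_zero (hy s hms)
    have h2 : s ^ d ≠ 0 := by positivity
    have := (mul_eq_zero.1 h1).resolve_left h2
    linarith
  have hg0 : 0 < d * w s / s := by positivity
  have hg : HasDerivAt (fun r => d * w r / r) (-(d + 1) * (d * w s / s) / s) s := by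
    refine (((hf.hasDerivAt hms).const_mul d).div (hasDerivAt_id s) hs0.ne').congr_deriv ?_
    rw [hus]; simp only [id]; field_simp; ring
  have hvs : phiP p (u s) = -(d * w s / s) ^ (p - 1) := by
    rw [hus, phiP_neg, phiP_of_pos p hg0]
  have hh := (hf.hasDerivAt_phi hms).add (hg.rpow_const (p := p - 1) (Or.inl hg0.ne'))
  have hev := exists_right_pos_of_hasDerivAt hh (by simp [hvs]) (by
    have h := hε (w s) ⟨hws, hsmall s hs⟩ s hms.le
    refine h.trans_eq ?_
    rw [hvs, hus, abs_of_pos hws, Real.rpow_sub_one hg0.ne' (p - 1)]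
    generalize (d * w s / s) ^ (p - 1) = A
    field_simp
    ring)
  obtain ⟨c, hc, hcpos⟩ := mem_nhdsGT_iff_exists_Ioo_subset.1 hev
  have hc : s < c := hc
  have hcb : s < min c b := lt_min hc hs.2
  obtain ⟨e, hse, heb⟩ := exists_between hcb
  have hmono : StrictMonoOn (fun r => r ^ d * w r) (Icc s e) := by
    refine strictMonoOn_of_hasDerivWithinAt_pos (convex_Icc s e)
      (fun r hr => (hy r (hms.trans_le hr.1)).continuousAt.continuousWithinAt)
      (fun r hr => (hy r (hms.trans_le (interior_subset hr).1)).hasDerivWithinAt) ?_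
    intro r hr
    rw [interior_Icc] at hr
    have hr0 : 0 < r := hs0.trans hr.1
    have hwr : 0 < w r := hpos r
      ⟨hs.1.trans hr.1, hr.2.trans (heb.trans_le (min_le_right _ _))⟩
    have h1 : 0 < phiP p (u r) + (d * w r / r) ^ (p - 1) :=
      hcpos ⟨hr.1, hr.2.trans (heb.trans_le (min_le_left _ _))⟩
    have h2 := neg_lt_of_neg_rpow_lt_phiP hp (by positivity : 0 < d * w r / r)
      (by linarith)
    exact mul_pos (by positivity) (by linarith)
  have h1 := hmono (left_mem_Icc.2 hse.le) (right_mem_Icc.2 hse.le) hse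
  have h2 := hmax (show e ∈ Icc a b from
    ⟨(hs.1.trans hse).le, (heb.trans_le (min_le_right _ _)).le⟩)
  exact absurd h2 (not_le.2 h1)

/-- If `α < N` then `w` has no small positive bumps, by monotonicity of
`r ^ N * w + r ^ (N - 1) * φ_p(w')`. -/
lemma IsFlow.no_pos_bump_of_lt (hf : IsFlow N p q α m w u) (hN : 1 ≤ N) (hm : 0 < m)
    {ε : ℝ} (hε : ∀ x ∈ Ioo 0 ε, 0 < (N : ℝ) - α - x ^ (q - 1))
    {a b : ℝ} (ha : m ≤ a) (hab : a < b) (hwa : w a = 0) (hwb : w b = 0) (hua : u a ≠ 0)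
    (hpos : ∀ r ∈ Ioo a b, 0 < w r) (hsmall : ∀ r ∈ Ioo a b, w r < ε) : False := by
  have hsub : Icc a b ⊆ Ici m := fun r hr => ha.trans hr.1
  have ha0 : 0 < a := hm.trans_le ha
  have hua' : 0 < u a := by
    exact lt_of_le_of_ne (deriv_nonneg_of_nonneg_right ((hf.hasDeriv a ha).mono
      (Ioi_subset_Ici ha)) hwa hab fun r hr => (hpos r hr).le) hua.symm
  have hub : u b ≤ 0 := by
    have h := (hf.hasDerivAt (ha.trans_lt hab)).hasDerivWithinAt (s := Iio b)
    exact deriv_nonpos_of_nonneg_left h hwb hab fun r hr => (hpos r hr).le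
  obtain ⟨n, rfl⟩ : ∃ n, N = n + 1 := ⟨N - 1, by omega⟩
  have hJ : ∀ r, m < r → HasDerivAt (fun r => r ^ (n + 1) * w r + r ^ n * phiP p (u r))
      (r ^ n * (((n + 1 : ℕ) : ℝ) - α - |w r| ^ (q - 1)) * w r) r := fun r hr => by
    have hr0 : 0 < r := hm.trans hr
    refine (((hasDerivAt_pow (n + 1) r).mul (hf.hasDerivAt hr)).add
      ((hasDerivAt_pow n r).mul (hf.hasDerivAt_phi hr))).congr_deriv ?_
    rcases n with _ | n
    · simp; ring
    · push_cast
      field_simp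
      ring
  have hJc : ContinuousOn (fun r => r ^ (n + 1) * w r + r ^ n * phiP p (u r)) (Icc a b) :=
    ((continuousOn_pow _).mul (hf.continuousOn.mono hsub)).add
      ((continuousOn_pow _).mul (hf.continuousOn_phi.mono hsub))
  have hmono := monotoneOn_of_hasDerivWithinAt_nonneg (convex_Icc a b) hJc (fun r hr =>
    (hJ r (by rw [interior_Icc] at hr; exact ha.trans_lt hr.1)).hasDerivWithinAt) (by
      intro r hr
      rw [interior_Icc] at hr
      have hr0 : 0 < r := ha0.trans hr.1
      have hw := hpos r hr
      have := hε (w r) ⟨hw, hsmall r hr⟩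
      rw [abs_of_pos hw]
      positivity)
  have h := hmono (left_mem_Icc.2 hab.le) (right_mem_Icc.2 hab.le) hab.le
  simp only [hwa, hwb, mul_zero, zero_add] at h
  have h1 : 0 < a ^ n * phiP p (u a) := mul_pos (by positivity) (phiP_pos p hua')
  have h2 : 0 ≤ b ^ n * phiP p (-u b) :=
    mul_nonneg (by have := ha0.trans hab; positivity) (phiP_nonneg p (by linarith))
  rw [phiP_neg] at h2
  linarith

lemma sign_const_of_ne_zero {f : ℝ → ℝ} {a b : ℝ} (hf : ContinuousOn f (Ioo a b))
    (h0 : ∀ r ∈ Ioo a b, f r ≠ 0) : (∀ r ∈ Ioo a b, 0 < f r) ∨ ∀ r ∈ Ioo a b, f r < 0 := by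
  by_contra! h
  obtain ⟨⟨x, hx, hfx⟩, y, hy, hfy⟩ := h
  obtain ⟨z, hz, hfz⟩ := isPreconnected_Ioo.intermediate_value hx hy hf ⟨hfx, hfy⟩
  exact h0 z hz hfz

lemma exists_bound_of_tendsto {g : ℝ → ℝ} {c : ℝ} (hg : Tendsto g (𝓝[>] 0) (𝓝 c))
    (hc : 0 < c) : ∃ ε > 0, ∀ x ∈ Ioo 0 ε, 0 < g x := by
  obtain ⟨ε, hε, h⟩ := mem_nhdsGT_iff_exists_Ioo_subset.1 (hg.eventually (lt_mem_nhds hc))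
  exact ⟨ε, hε, h⟩

lemma tendsto_rpow_nhdsGT_zero {s : ℝ} (hs : 0 < s) :
    Tendsto (fun x : ℝ => x ^ s) (𝓝[>] 0) (𝓝 0) := by
  have := (Real.continuousAt_rpow_const 0 s (Or.inr hs.le)).tendsto
  rw [Real.zero_rpow hs.ne'] at this
  exact this.mono_left nhdsWithin_le_nhds

/-- Under the hypothesis on `p` and `α`, bumps between zeros cannot be arbitrarily small. -/
lemma exists_forall_bump_ge (hN : 1 ≤ N) (hp : 1 < p) (hq : 1 < q) (hα : 0 < α)
    (h : 2 < p ∨ α < max (N : ℝ) (((N : ℝ) - p) / (p - 1))) (hm : 0 < m) :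
    ∃ ε > 0, ∀ w u : ℝ → ℝ, IsFlow N p q α m w u → ∀ a b, m ≤ a → a < b → w a = 0 → w b = 0 →
      u a ≠ 0 → (∀ r ∈ Ioo a b, w r ≠ 0) → ∃ r ∈ Ioo a b, ε ≤ |w r| := by
  have hq' := tendsto_rpow_nhdsGT_zero (by linarith : 0 < q - 1)
  have hN' : (1 : ℝ) ≤ N := by exact_mod_cast hN
  have hp' : 0 < p - 1 := by linarith
  suffices H : ∃ ε > 0, ∀ w u : ℝ → ℝ, IsFlow N p q α m w u → ∀ a b, m ≤ a → a < b → w a = 0 →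
      w b = 0 → u a ≠ 0 → (∀ r ∈ Ioo a b, 0 < w r) → (∀ r ∈ Ioo a b, w r < ε) → False by
    obtain ⟨ε, hε, H⟩ := H
    refine ⟨ε, hε, fun w u hf a b ha hab hwa hwb hua h0 => ?_⟩
    by_contra! hsmall
    rcases sign_const_of_ne_zero (hf.continuousOn.mono fun r hr => ha.trans hr.1.le) h0
      with hs | hs
    · exact H w u hf a b ha hab hwa hwb hua hs fun r hr => (le_abs_self _).trans_lt (hsmall r hr)
    · exact H _ _ hf.neg a b ha hab (by simp [hwa]) (by simp [hwb]) (by simpa using hua)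
        (fun r hr => neg_pos.2 (hs r hr)) fun r hr => (neg_le_abs _).trans_lt (hsmall r hr)
  rcases h with h | h
  · set d := α + 1 with hd
    set K := (p - 1) * (d + 1) * ((d / m) ^ (p - 1) / m) with hK
    have hlim : Tendsto (fun x : ℝ => 1 - x ^ (q - 1) - K * x ^ (p - 2)) (𝓝[>] 0) (𝓝 1) := by
      simpa using (tendsto_const_nhds.sub hq').sub
        ((tendsto_rpow_nhdsGT_zero (by linarith : 0 < p - 2)).const_mul K)
    obtain ⟨ε, hε, hlt⟩ := exists_bound_of_tendsto hlim one_pos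
    refine ⟨ε, hε, fun w u hf a b ha hab hwa hwb _ hpos hsmall =>
      hf.no_pos_bump_of_rpow hp hm (d := d) (by positivity) (fun x hx s hs => ?_)
        ha hab hwa hwb hpos hsmall⟩
    have hx0 : 0 < x := hx.1
    have hd0 : 0 < d := by positivity
    have hs0 : 0 < s := hm.trans_le hs
    have h1 : (d * x / s) ^ (p - 1) / s ≤ (d * x / m) ^ (p - 1) / m := by gcongr
    have h2 : (d * x / m) ^ (p - 1) / m = x * x ^ (p - 2) * ((d / m) ^ (p - 1) / m) := by
      rw [show d * x / m = d / m * x by ring, Real.mul_rpow (by positivity) hx0.le,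
        show p - 1 = p - 2 + 1 by ring, Real.rpow_add_one hx0.ne']
      ring
    have h3 : 0 ≤ (d * x / s) ^ (p - 1) / s * ((N : ℝ) - 1) :=
      mul_nonneg (by positivity) (by linarith)
    have h4 : (p - 1) * (d + 1) * ((d * x / s) ^ (p - 1) / s) ≤ x * (K * x ^ (p - 2)) := by
      calc _ ≤ (p - 1) * (d + 1) * ((d * x / m) ^ (p - 1) / m) := by gcongr
        _ = _ := by rw [h2, hK]; ring
    have h5 := mul_pos hx0 (hlt x hx)
    have h6 : x * (d - α - x ^ (q - 1)) = x * (1 - x ^ (q - 1)) := by rw [hd]; ring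
    rw [h6]
    linarith
  · rcases lt_max_iff.1 h with h | h
    · have hlim : Tendsto (fun x : ℝ => (N : ℝ) - α - x ^ (q - 1)) (𝓝[>] 0) (𝓝 (N - α)) := by
        simpa using tendsto_const_nhds.sub hq'
      obtain ⟨ε, hε, hlt⟩ := exists_bound_of_tendsto hlim (by linarith)
      exact ⟨ε, hε, fun w u hf a b ha hab hwa hwb hua hpos hsmall =>
        hf.no_pos_bump_of_lt hN hm hlt ha hab hwa hwb hua hpos hsmall⟩
    · set d := ((N : ℝ) - p) / (p - 1) with hd
      have hlim : Tendsto (fun x : ℝ => d - α - x ^ (q - 1)) (𝓝[>] 0) (𝓝 (d - α)) := by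
        simpa using tendsto_const_nhds.sub hq'
      obtain ⟨ε, hε, hlt⟩ := exists_bound_of_tendsto hlim (by linarith)
      refine ⟨ε, hε, fun w u hf a b ha hab hwa hwb _ hpos hsmall =>
        hf.no_pos_bump_of_rpow hp hm (hα.trans h) (fun x hx s hs => ?_)
          ha hab hwa hwb hpos hsmall⟩
      have h1 : (N : ℝ) - 1 - (p - 1) * (d + 1) = 0 := by
        rw [hd]; field_simp; ring
      rw [h1, mul_zero, zero_add]
      exact mul_pos hx.1 (hlt x hx)

namespace IsFlow

/-- After a simple zero followed by another zero, the first critical point has small height. -/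
lemma exists_critical_le (hf : IsFlow N p q α m w u) (hN : 1 ≤ N) (hα : 0 < α) (hm : 0 < m)
    {a c : ℝ} (ha : m ≤ a) (hac : a < c) (hwa : w a = 0) (hwc : w c = 0) (hua : 0 < u a) :
    ∃ s, a ≤ s ∧ u s = 0 ∧ 0 ≤ w s ∧ a * w s ≤ phiP p (u a) := by
  have hN' : (1 : ℝ) ≤ N := by exact_mod_cast hN
  have ha0 : 0 < a := hm.trans_le ha
  have hsub : Icc a c ⊆ Ici m := fun r hr => ha.trans hr.1
  obtain ⟨t, ht, hut⟩ := exists_hasDerivAt_eq_zero hac (hf.continuousOn.mono hsub)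
    (hwa.trans hwc.symm) fun x hx => hf.hasDerivAt (ha.trans_lt hx.1)
  have hclosed : IsClosed (Icc a c ∩ u ⁻¹' {0}) :=
    (hf.cont.mono hsub).preimage_isClosed_of_isClosed isClosed_Icc isClosed_singleton
  obtain ⟨s, ⟨hs, hus⟩, hleast⟩ := (isCompact_Icc.of_isClosed_subset hclosed
    inter_subset_left).exists_isLeast ⟨t, Ioo_subset_Icc_self ht, hut⟩
  have hus : u s = 0 := hus
  have hsubs : Icc a s ⊆ Ici m := fun r hr => ha.trans hr.1
  have hupos : ∀ r ∈ Icc a s, 0 ≤ u r := by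
    intro r hr
    by_contra! hneg
    obtain ⟨z, hz, huz⟩ := intermediate_value_Icc' hr.1
      (hf.cont.mono fun x hx => ha.trans hx.1) ⟨hneg.le, hua.le⟩
    have hzs : s ≤ z := hleast ⟨⟨hz.1, (hz.2.trans hr.2).trans hs.2⟩, huz⟩
    have : r = s := le_antisymm hr.2 (hzs.trans hz.2)
    rw [this, hus] at hneg
    exact lt_irrefl _ hneg
  have hint : ∀ r ∈ interior (Icc a s), m < r ∧ 0 < r ∧ a ≤ r ∧ r ∈ Icc a s := by
    intro r hr
    rw [interior_Icc] at hr
    exact ⟨ha.trans_lt hr.1, ha0.trans hr.1, hr.1.le, hr.1.le, hr.2.le⟩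
  have hmono : MonotoneOn w (Icc a s) := monotoneOn_of_hasDerivWithinAt_nonneg (convex_Icc a s)
    (hf.continuousOn.mono hsubs) (fun r hr => (hf.hasDerivAt (hint r hr).1).hasDerivWithinAt)
    fun r hr => hupos r (hint r hr).2.2.2
  have hwpos : ∀ r ∈ Icc a s, 0 ≤ w r := fun r hr =>
    hwa ▸ hmono (left_mem_Icc.2 hs.1) hr hr.1
  have hanti : AntitoneOn (fun r => phiP p (u r) + a * w r) (Icc a s) := by
    refine antitoneOn_of_hasDerivWithinAt_nonpos (convex_Icc a s)
      ((hf.continuousOn_phi.mono hsubs).add ((hf.continuousOn.mono hsubs).const_mul a))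
      (fun r hr => ((hf.hasDerivAt_phi (hint r hr).1).add
        ((hf.hasDerivAt (hint r hr).1).const_mul a)).hasDerivWithinAt) fun r hr => ?_
    obtain ⟨-, hr0, har, hr'⟩ := hint r hr
    have h1 := hupos r hr'
    have h2 := hwpos r hr'
    have h3 : 0 ≤ ((N : ℝ) - 1) / r * phiP p (u r) :=
      mul_nonneg (div_nonneg (by linarith) hr0.le) (phiP_nonneg p h1)
    have h4 : 0 ≤ α * w r := by positivity
    have h5 : 0 ≤ |w r| ^ (q - 1) * w r := by positivity
    have h6 := mul_le_mul_of_nonneg_right har h1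
    linarith
  have h := hanti (left_mem_Icc.2 hs.1) (right_mem_Icc.2 hs.1) hs.1
  simp only [hus, phiP_zero, hwa, mul_zero, zero_add, add_zero] at h
  exact ⟨s, hs.1, hus, hwpos s (right_mem_Icc.2 hs.1), h⟩

lemma exists_critical_abs_le (hf : IsFlow N p q α m w u) (hN : 1 ≤ N) (hα : 0 < α) (hm : 0 < m)
    {a c : ℝ} (ha : m ≤ a) (hac : a < c) (hwa : w a = 0) (hwc : w c = 0) (hua : u a ≠ 0) :
    ∃ s, a ≤ s ∧ u s = 0 ∧ a * |w s| ≤ |phiP p (u a)| := by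
  rcases hua.lt_or_gt with h | h
  · obtain ⟨s, h1, h2, h3, h4⟩ := hf.neg.exists_critical_le hN hα hm ha hac (by simp [hwa])
      (by simp [hwc]) (neg_pos.2 h)
    refine ⟨s, h1, by simpa using h2, ?_⟩
    rw [← abs_neg (w s), abs_of_nonneg h3]
    rw [phiP_neg] at h4
    exact h4.trans (neg_le_abs _)
  · obtain ⟨s, h1, h2, h3, h4⟩ := hf.exists_critical_le hN hα hm ha hac hwa hwc h
    refine ⟨s, h1, h2, ?_⟩
    rw [abs_of_nonneg h3]
    exact h4.trans (le_abs_self _)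

lemma ne_zero_of_isolated (hf : IsFlow N p q α m w u) (hN : 1 ≤ N) (hp : 1 < p) (hq : 1 < q)
    (hα : 0 < α) (hm : 0 < m) {z : ℝ} (hz : IsIsolatedZeroOn w (Ici m) z) {R : ℝ} (hR : m ≤ R)
    (hRz : R ≤ z) : ¬ (w R = 0 ∧ u R = 0) := by
  rintro ⟨hwR, huR⟩
  have hzm : m ≤ z := hz.1
  have hsub : Ioi z ⊆ Ici m \ {z} := fun r hr => ⟨hzm.trans (le_of_lt hr), ne_of_gt hr⟩
  have h1 : ∀ᶠ r in 𝓝[>] z, w r ≠ 0 := hz.2.2.filter_mono (nhdsWithin_mono z hsub)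
  obtain ⟨r, hr, hzr⟩ := (h1.and self_mem_nhdsWithin).exists
  have hRr : R ≤ r := hRz.trans (le_of_lt hzr)
  have h2 := hf.antitoneOn_energy hN hp hq hm hR (hR.trans hRr) hRr
  rw [energy_eq_zero hp hq hwR huR] at h2
  have h3 := (sq_le_energy hp hq r).trans h2
  have : 0 < α / 2 * w r ^ 2 := by positivity
  linarith

lemma exists_next_zero (hf : IsFlow N p q α m w u) {a c : ℝ}
    (ha : IsIsolatedZeroOn w (Ici m) a) (hac : a < c) (hwc : w c = 0) :
    ∃ b, a < b ∧ b ≤ c ∧ w b = 0 ∧ ∀ r ∈ Ioo a b, w r ≠ 0 := by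
  have ham : m ≤ a := ha.1
  have hIoi : Ioi a ⊆ Ici m \ {a} := fun r hr => ⟨ham.trans (le_of_lt hr), ne_of_gt hr⟩
  have h1 : ∀ᶠ r in 𝓝[>] a, w r ≠ 0 := ha.2.2.filter_mono (nhdsWithin_mono a hIoi)
  obtain ⟨e, he, hsub⟩ := mem_nhdsGT_iff_exists_Ioo_subset.1 h1
  have he : a < e := he
  have hec : e ≤ c := by
    by_contra! hce
    exact hsub ⟨hac, hce⟩ hwc
  have hclosed : IsClosed (Icc e c ∩ w ⁻¹' {0}) :=
    (hf.continuousOn.mono fun r hr => (ham.trans he.le).trans hr.1).preimage_isClosed_of_isClosed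
      isClosed_Icc isClosed_singleton
  obtain ⟨b, ⟨hb, hwb⟩, hleast⟩ := (isCompact_Icc.of_isClosed_subset hclosed
    inter_subset_left).exists_isLeast ⟨c, right_mem_Icc.2 hec, hwc⟩
  refine ⟨b, he.trans_le hb.1, hb.2, hwb, fun r hr hwr => ?_⟩
  rcases lt_or_ge r e with hre | hre
  · exact hsub ⟨hr.1, hre⟩ hwr
  · exact absurd (hleast ⟨⟨hre, (hr.2.le).trans hb.2⟩, hwr⟩) (not_le.2 hr.2)

/-- Unboundedly many isolated zeros force the energy to decay. -/
lemma exists_energy_lt (hf : IsFlow N p q α m w u) (hN : 1 ≤ N) (hp : 1 < p) (hq : 1 < q)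
    (hα : 0 < α) (hm : 0 < m) (hZ : ¬ BddAbove {r | IsIsolatedZeroOn w (Ici m) r})
    {ε : ℝ} (hε : 0 < ε) : ∃ s, m ≤ s ∧ energy p q α w u s < ε := by
  rw [not_bddAbove_iff] at hZ
  have hp1 : 1 < p / (p - 1) := by rw [lt_div_iff₀ (by linarith)]; linarith
  set D := energy p q α w u m / ((p - 1) / p) with hD
  have hDpos : 0 < (p - 1) / p := div_pos (by linarith) (by linarith)
  have hbound : ∀ a, m ≤ a → |phiP p (u a)| ≤ max 1 D := by
    intro a ha
    rcases le_total |phiP p (u a)| 1 with h | h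
    · exact h.trans (le_max_left _ _)
    · refine le_max_of_le_right ((Real.self_le_rpow_of_one_le h hp1.le).trans ?_)
      rw [hD, le_div_iff₀' hDpos]
      exact (phi_le_energy hq hα a).trans (hf.antitoneOn_energy hN hp hq hm self_mem_Ici ha ha)
  have hG : ContinuousAt (fun x : ℝ => α / 2 * x ^ 2 + |x| ^ (q + 1) / (q + 1)) 0 := by
    refine ContinuousAt.add (by fun_prop) (ContinuousAt.div_const ?_ _)
    exact continuousAt_id.abs.rpow_const (Or.inr (by linarith))
  have hG0 : ∀ᶠ x : ℝ in 𝓝 0, α / 2 * x ^ 2 + |x| ^ (q + 1) / (q + 1) < ε := by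
    refine hG.eventually (gt_mem_nhds ?_)
    simpa [Real.zero_rpow (by linarith : q + 1 ≠ 0)] using hε
  obtain ⟨δ, hδ, hsmall⟩ := Metric.eventually_nhds_iff.1 hG0
  obtain ⟨a, ha, hlarge⟩ := hZ (max 1 D / δ)
  obtain ⟨c, hc, hac⟩ := hZ a
  have hua : u a ≠ 0 := fun hu =>
    hf.ne_zero_of_isolated hN hp hq hα hm ha ha.1 le_rfl ⟨ha.2.1, hu⟩
  obtain ⟨s, has, hus, hle⟩ := hf.exists_critical_abs_le hN hα hm ha.1 hac ha.2.1 hc.2.1 hua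
  have ham : m ≤ a := ha.1
  refine ⟨s, ham.trans has, ?_⟩
  have hws : |w s| < δ := by
    have h1 := hle.trans (hbound a ham)
    rw [div_lt_iff₀ hδ] at hlarge
    exact lt_of_mul_lt_mul_left (h1.trans_lt hlarge) (hm.le.trans ham)
  have hp0 : p / (p - 1) ≠ 0 := by linarith
  have h2 := hsmall (y := w s) (by simpa [Real.dist_eq] using hws)
  simpa [energy, hus, phiP_zero, Real.zero_rpow hp0] using h2

/-- A finite accumulation point of zeros is a double zero. -/
lemma eq_zero_of_accPt (hf : IsFlow N p q α m w u) {R : ℝ} (hR : m ≤ R)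
    (hacc : AccPt R (𝓟 {r | IsIsolatedZeroOn w (Ici m) r})) : w R = 0 ∧ u R = 0 := by
  have hfreq : ∃ᶠ y in 𝓝[Ici m \ {R}] R, w y = 0 := by
    rw [accPt_iff_frequently] at hacc
    rw [frequently_nhdsWithin_iff]
    exact hacc.mono fun y hy => ⟨hy.2.2.1, hy.2.1, hy.1⟩
  have hwR : w R = 0 := by
    by_contra hne
    have hc : ContinuousWithinAt w (Ici m \ {R}) R := (hf.continuousOn R hR).mono sdiff_subset
    have h := hc.eventually_ne hne
    obtain ⟨y, hy, hy'⟩ := (hfreq.and_eventually h).exists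
    exact hy' hy
  refine ⟨hwR, ?_⟩
  by_contra hne
  have h := (hasDerivWithinAt_iff_tendsto_slope.1 (hf.hasDeriv R hR)).eventually_ne hne
  obtain ⟨y, hy, hy'⟩ := (hfreq.and_eventually h).exists
  exact hy' (by simp [slope_def_field, hy, hwR])

theorem finite_isolatedZeros (hf : IsFlow N p q α m w u) (hN : 1 ≤ N) (hp : 1 < p) (hq : 1 < q)
    (hα : 0 < α) (h : 2 < p ∨ α < max (N : ℝ) (((N : ℝ) - p) / (p - 1))) (hm : 0 < m) :
    {r : ℝ | IsIsolatedZeroOn w (Ici m) r}.Finite := by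
  by_contra hinf
  obtain ⟨ε, hε, hbump⟩ := exists_forall_bump_ge hN hp hq hα h hm
  have hsimple : ∀ z, IsIsolatedZeroOn w (Ici m) z → u z ≠ 0 := fun z hz hu =>
    hf.ne_zero_of_isolated hN hp hq hα hm hz hz.1 le_rfl ⟨hz.2.1, hu⟩
  by_cases hbdd : BddAbove {r | IsIsolatedZeroOn w (Ici m) r}
  · obtain ⟨M, hM⟩ := hbdd
    obtain ⟨R, hR, hacc⟩ := Set.Infinite.exists_accPt_of_subset_isCompact hinf
      (isCompact_Icc (a := m) (b := M)) fun z hz => ⟨hz.1, hM hz⟩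
    obtain ⟨hwR, huR⟩ := hf.eq_zero_of_accPt hR.1 hacc
    have hcont := hf.continuousOn R hR.1
    obtain ⟨δ, hδ, hsmall⟩ := Metric.continuousWithinAt_iff.1 hcont ε hε
    obtain ⟨a, ⟨-, ha⟩, haR⟩ := ((accPt_iff_frequently.1 hacc).and_eventually
      (Metric.ball_mem_nhds R hδ)).exists
    have haR' : a < R := by
      by_contra! hle
      exact hf.ne_zero_of_isolated hN hp hq hα hm ha hR.1 hle ⟨hwR, huR⟩
    have ham : m ≤ a := ha.1
    obtain ⟨b, hab, hbR, hwb, hne⟩ := hf.exists_next_zero ha haR' hwR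
    obtain ⟨r, hr, hge⟩ := hbump w u hf a b ham hab ha.2.1 hwb (hsimple a ha) hne
    have hrd : dist r R < δ := by
      have h1 : dist a R < δ := haR
      rw [Real.dist_eq, abs_sub_comm, abs_of_pos (sub_pos.2 haR')] at h1
      rw [Real.dist_eq, abs_sub_comm, abs_of_nonneg (by linarith [hr.2])]
      linarith [hr.1]
    have := hsmall (ham.trans hr.1.le) hrd
    rw [hwR, Real.dist_eq, sub_zero] at this
    linarith
  · obtain ⟨s, hs, hEs⟩ := hf.exists_energy_lt hN hp hq hα hm hbdd
      (by positivity : 0 < α / 2 * ε ^ 2)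
    obtain ⟨a, ha, hsa⟩ := not_bddAbove_iff.1 hbdd s
    obtain ⟨c, hc, hac⟩ := not_bddAbove_iff.1 hbdd a
    obtain ⟨b, hab, -, hwb, hne⟩ := hf.exists_next_zero ha hac hc.2.1
    obtain ⟨r, hr, hge⟩ := hbump w u hf a b ha.1 hab ha.2.1 hwb (hsimple a ha) hne
    have hsr : s ≤ r := (hsa.trans hr.1).le
    have h1 := (sq_le_energy hp hq r).trans
      (hf.antitoneOn_energy hN hp hq hm hs (hs.trans hsr) hsr)
    have h2 : ε ^ 2 ≤ w r ^ 2 := by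
      rw [← sq_abs (w r)]; gcongr
    have h3 : α / 2 * ε ^ 2 ≤ α / 2 * w r ^ 2 := by gcongr
    linarith

end IsFlow

end Flow

/-- Assume `p > 2` or `α < max(N, η)` with `η = (N-p)/(p-1)`. Then for any `m > 0`,
any solution of (E) on `[m,∞)` either vanishes identically on `[m,∞)` or has only
finitely many isolated zeros in `[m,∞)`. -/
theorem stmt4 (N : ℕ) (hN : 1 ≤ N) (p q α : ℝ) (hp : 1 < p) (hq : 1 < q) (hα : 0 < α)
    (h : 2 < p ∨ α < max (N : ℝ) (((N : ℝ) - p) / (p - 1)))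
    (m : ℝ) (hm : 0 < m) (w : ℝ → ℝ) (hw : IsSolutionOn N p q α w (Ici m)) :
    (∀ r ∈ Ici m, w r = 0) ∨ {r : ℝ | IsIsolatedZeroOn w (Ici m) r}.Finite := by
  exact Or.inr (hw.isFlow.finite_isolatedZeros hN hp hq hα h hm)
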